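/- Let B be a real Banach space whose norm satisfies condition (*) with parameters s ∈ [2,∞) and m > 0, let (T(u))_{u≥0} be a C₀ semigroup of contractions on B, and let r ≥ 1 be an integer. Then there is a constant C > 0 such that for all f ∈ B and t > 0: ω_T^r(f, t) ≥ C ( ∑_{j=1}^∞ 2^{−jrs} ω_T^{r+1}(f, 2^j t)^s )^{1/s}, where ω_T^k(f, t) = sup_{0 ≤ u ≤ t} ‖(T(u) − I)^k f‖. -/

import Mathlib

open Filter

/-- The modulus of smoothness of a semigroup,
`ω_T^k(f,t) = sup_{0 ≤ u ≤ t} ‖(T(u) − I)^k f‖`. -/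
noncomputable def omegaT {B : Type*} [NormedAddCommGroup B] [NormedSpace ℝ B]
    (T : ℝ → B →L[ℝ] B) (k : ℕ) (f : B) (t : ℝ) : ℝ :=
  sSup {v : ℝ | ∃ u : ℝ, 0 ≤ u ∧ u ≤ t ∧ v = ‖((T u - 1 : B →L[ℝ] B) ^ k) f‖}

section Ring

open Finset

variable {R : Type*} [Ring R]

theorem sub_one_pow_eq_sum (z : R) (k : ℕ) : (z - 1) ^ k =
    ∑ i ∈ range (k + 1), ((-1) ^ (k + i) * (k.choose i : ℤ)) • z ^ i := by
  rw [sub_eq_add_neg, (Commute.neg_one_right z).add_pow]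
  refine sum_congr rfl fun i hi => ?_
  have hi' : i ≤ k := Nat.lt_succ_iff.mp (mem_range.mp hi)
  have hsign : (-1 : R) ^ (k + i) = (-1) ^ (k - i) := by
    rw [show k + i = (k - i) + 2 * i by omega, pow_add, pow_mul]
    simp
  rw [zsmul_eq_mul]
  push_cast
  rw [hsign, mul_assoc]
  exact (((Commute.neg_one_right (z ^ i)).pow_right _).mul_right (Nat.commute_cast _ _)).eq

theorem Commute.sum_choose_mul_pow_sub_one_pow {x y : R} (h : Commute x y) (k : ℕ) :
    ∑ l ∈ range (k + 1), ((-1) ^ l * (k.choose l : ℤ)) • (x * y ^ l - 1) ^ k =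
      ∑ i ∈ range (k + 1), ((-1) ^ i * (k.choose i : ℤ)) • (x ^ i * (y ^ i - 1) ^ k) := by
  simp only [sub_one_pow_eq_sum, smul_sum, mul_sum]
  rw [sum_comm]
  refine sum_congr rfl fun i _ => sum_congr rfl fun l _ => ?_
  rw [(h.pow_right l).mul_pow, ← pow_mul, ← pow_mul, mul_comm i l, mul_smul_comm, smul_smul,
    smul_smul]
  congr 1
  ring

end Ring

section Contraction

variable {B : Type*} [NormedAddCommGroup B] [NormedSpace ℝ B]

theorem ContinuousLinearMap.norm_pow_apply_le {A : B →L[ℝ] B} {c : ℝ} (hc : 0 ≤ c)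
    (hA : ∀ f, ‖A f‖ ≤ c * ‖f‖) (n : ℕ) (f : B) : ‖(A ^ n) f‖ ≤ c ^ n * ‖f‖ := by
  induction n with
  | zero => simp
  | succ n ih =>
    rw [pow_succ', mul_apply_eq_comp]
    calc ‖A ((A ^ n) f)‖ ≤ c * ‖(A ^ n) f‖ := hA _
      _ ≤ c * (c ^ n * ‖f‖) := by gcongr
      _ = c ^ (n + 1) * ‖f‖ := by ring

theorem norm_pow_apply_le_of_contraction {S : B →L[ℝ] B} (hS : ∀ f, ‖S f‖ ≤ ‖f‖) (n : ℕ) (f : B) :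
    ‖(S ^ n) f‖ ≤ ‖f‖ := by
  simpa using ContinuousLinearMap.norm_pow_apply_le zero_le_one (by simpa using hS) n f

theorem norm_sub_one_pow_apply_le {S : B →L[ℝ] B} (hS : ∀ f, ‖S f‖ ≤ ‖f‖) (n : ℕ) (f : B) :
    ‖((S - 1) ^ n) f‖ ≤ 2 ^ n * ‖f‖ := by
  refine ContinuousLinearMap.norm_pow_apply_le zero_le_two (fun g => ?_) n f
  calc ‖(S - 1) g‖ = ‖S g - g‖ := by simp
    _ ≤ ‖S g‖ + ‖g‖ := norm_sub_le _ _
    _ ≤ 2 * ‖g‖ := by linarith [hS g]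

theorem norm_add_one_pow_apply_le {S : B →L[ℝ] B} (hS : ∀ f, ‖S f‖ ≤ ‖f‖) (n : ℕ) (f : B) :
    ‖((S + 1) ^ n) f‖ ≤ 2 ^ n * ‖f‖ := by
  refine ContinuousLinearMap.norm_pow_apply_le zero_le_two (fun g => ?_) n f
  calc ‖(S + 1) g‖ = ‖S g + g‖ := by simp
    _ ≤ ‖S g‖ + ‖g‖ := norm_add_le _ _
    _ ≤ 2 * ‖g‖ := by linarith [hS g]

theorem norm_pow_sub_one_pow_apply_le {S : B →L[ℝ] B} (hS : ∀ f, ‖S f‖ ≤ ‖f‖) (n k : ℕ) (f : B) :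
    ‖((S ^ n - 1) ^ k) f‖ ≤ (n : ℝ) ^ k * ‖((S - 1) ^ k) f‖ := by
  have hcomm : Commute (∑ i ∈ Finset.range n, S ^ i) (S - 1) :=
    Commute.sum_left _ _ _ fun i _ =>
      ((Commute.refl S).pow_left i).sub_right (Commute.one_right _)
  rw [← geom_sum_mul, hcomm.mul_pow, mul_apply_eq_comp]
  refine ContinuousLinearMap.norm_pow_apply_le n.cast_nonneg (fun g => ?_) k _
  rw [sum_apply]
  calc ‖∑ i ∈ Finset.range n, (S ^ i) g‖ ≤ ∑ i ∈ Finset.range n, ‖g‖ :=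
        norm_sum_le_of_le _ fun i _ => norm_pow_apply_le_of_contraction hS i g
    _ = n * ‖g‖ := by simp

theorem norm_sub_one_pow_apply_le_sum {x y : B →L[ℝ] B} (hx : ∀ f, ‖x f‖ ≤ ‖f‖)
    (h : Commute x y) {k : ℕ} (hk : k ≠ 0) (f : B) :
    ‖((x - 1) ^ k) f‖ ≤ ∑ l ∈ Finset.range k, (k.choose (l + 1) : ℝ) *
      (‖((y ^ (l + 1) - 1) ^ k) f‖ + ‖((x * y ^ (l + 1) - 1) ^ k) f‖) := by
  have key := h.sum_choose_mul_pow_sub_one_pow k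
  rw [Finset.sum_range_succ', Finset.sum_range_succ'] at key
  simp only [pow_zero, Nat.choose_zero_right, mul_one, one_mul, sub_self, zero_pow hk,
    Nat.cast_one, one_smul, add_zero] at key
  have key' := eq_sub_of_add_eq' key
  rw [← Finset.sum_sub_distrib] at key'
  rw [key', sum_apply]
  refine norm_sum_le_of_le _ fun l _ => ?_
  rw [← smul_sub, smul_apply, sub_apply,
    mul_apply_eq_comp, ← Int.cast_smul_eq_zsmul ℝ, norm_smul]
  have hc : ‖(((-1) ^ (l + 1) * (k.choose (l + 1) : ℤ) : ℤ) : ℝ)‖ = k.choose (l + 1) := by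
    push_cast
    simp
  rw [hc]
  gcongr
  exact (norm_sub_le _ _).trans
    (add_le_add_left (norm_pow_apply_le_of_contraction hx _ _) _)

theorem rpow_norm_sub_one_pow_ge {s m : ℝ} (hs : 0 < s) (hm : 0 < m)
    (hstar : ∀ F G : B, (‖F‖ ^ s + m * ‖G‖ ^ s) ^ (1 / s) ≤ max ‖F + G‖ ‖F - G‖)
    {S : B →L[ℝ] B} (hS : ∀ f, ‖S f‖ ≤ ‖f‖) {r : ℕ} (hr : 1 ≤ r) (f : B) :
    (2 : ℝ) ^ (-(r * s)) * ‖((S ^ 2 - 1 : B →L[ℝ] B) ^ r) f‖ ^ s +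
      m * (2 : ℝ) ^ (-s) * ‖((S - 1) ^ (r + 1)) f‖ ^ s ≤ ‖((S - 1) ^ r) f‖ ^ s := by
  set g := ((S - 1) ^ r) f with hg
  have h2 : (2 : ℝ) ^ (-s) = ((2 : ℝ)⁻¹) ^ s := by
    rw [Real.inv_rpow zero_le_two, Real.rpow_neg zero_le_two]
  have hscale (a : B) : ‖(2⁻¹ : ℝ) • a‖ ^ s = (2 : ℝ) ^ (-s) * ‖a‖ ^ s := by
    rw [norm_smul, Real.mul_rpow (norm_nonneg _) (norm_nonneg _), h2]
    norm_num
  have h0 := hstar ((2⁻¹ : ℝ) • (S + 1) g) ((2⁻¹ : ℝ) • (S - 1) g)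
  have e1 : (2⁻¹ : ℝ) • (S + 1) g + (2⁻¹ : ℝ) • (S - 1) g = S g := by
    simp only [add_apply, sub_apply,
      one_apply_eq_self]
    module
  have e2 : (2⁻¹ : ℝ) • (S + 1) g - (2⁻¹ : ℝ) • (S - 1) g = g := by
    simp only [add_apply, sub_apply,
      one_apply_eq_self]
    module
  rw [e1, e2, max_eq_right (hS g), one_div,
    Real.rpow_inv_le_iff_of_pos (by positivity) (norm_nonneg _) hs, hscale, hscale] at h0
  have hsucc : ((S - 1) ^ (r + 1)) f = (S - 1) g := by
    rw [pow_succ', mul_apply_eq_comp]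
  have hsq : ‖((S ^ 2 - 1 : B →L[ℝ] B) ^ r) f‖ ≤ 2 ^ (r - 1) * ‖(S + 1) g‖ := by
    have hcomm : Commute (S + 1) (S - 1) :=
      (((Commute.refl S).add_left (Commute.one_left _)).sub_right (Commute.one_right _))
    have : S ^ 2 - 1 = (S + 1) * (S - 1) := by noncomm_ring
    rw [this, hcomm.mul_pow, mul_apply_eq_comp, ← hg]
    obtain ⟨n, rfl⟩ : ∃ n, r = n + 1 := ⟨r - 1, by omega⟩
    rw [pow_succ, mul_apply_eq_comp]
    exact norm_add_one_pow_apply_le hS n _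
  have hpow : (2 : ℝ) ^ (-(r * s)) * ‖((S ^ 2 - 1 : B →L[ℝ] B) ^ r) f‖ ^ s ≤
      (2 : ℝ) ^ (-s) * ‖(S + 1) g‖ ^ s := by
    calc (2 : ℝ) ^ (-(r * s)) * ‖((S ^ 2 - 1 : B →L[ℝ] B) ^ r) f‖ ^ s
        ≤ (2 : ℝ) ^ (-(r * s)) * (2 ^ (r - 1) * ‖(S + 1) g‖) ^ s := by gcongr
      _ = (2 : ℝ) ^ (-s) * ‖(S + 1) g‖ ^ s := by
        rw [Real.mul_rpow (by positivity) (norm_nonneg _), ← Real.rpow_natCast,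
          ← Real.rpow_mul zero_le_two, ← mul_assoc, ← Real.rpow_add zero_lt_two,
          Nat.cast_sub hr]
        congr 2
        push_cast
        ring
  rw [hsucc, mul_assoc]
  linarith

end Contraction

section Real

open Finset MeasureTheory intervalIntegral

theorem Real.add_rpow_le_two_rpow_mul {a b s : ℝ} (ha : 0 ≤ a) (hb : 0 ≤ b) (hs : 0 ≤ s) :
    (a + b) ^ s ≤ 2 ^ s * (a ^ s + b ^ s) := by
  wlog h : a ≤ b generalizing a b
  · rw [add_comm a, add_comm (a ^ s)]
    exact this hb ha (le_of_not_ge h)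
  calc (a + b) ^ s ≤ (2 * b) ^ s := by gcongr; linarith
    _ = 2 ^ s * b ^ s := Real.mul_rpow zero_le_two hb
    _ ≤ 2 ^ s * (a ^ s + b ^ s) := by
      gcongr
      linarith [Real.rpow_nonneg ha s]

theorem Continuous.integral_comp_add_mul_le {φ : ℝ → ℝ} (hφ : Continuous φ) (hφ0 : ∀ u, 0 ≤ φ u)
    {d c t b : ℝ} (hd : 0 ≤ d) (hc : 1 ≤ c) (ht : 0 ≤ t) (hb : d + c * t ≤ b) :
    ∫ v in (0 : ℝ)..t, φ (d + c * v) ≤ ∫ u in (0 : ℝ)..b, φ u := by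
  have hc0 : 0 < c := by linarith
  have hct : 0 ≤ c * t := by positivity
  rw [integral_comp_add_mul _ hc0.ne', smul_eq_mul, mul_zero, add_zero]
  have h1 : ∫ u in d..(d + c * t), φ u ≤ ∫ u in (0 : ℝ)..b, φ u :=
    integral_mono_interval hd (by linarith) hb (Filter.Eventually.of_forall hφ0)
      (hφ.intervalIntegrable _ _)
  have h2 : 0 ≤ ∫ u in d..(d + c * t), φ u :=
    integral_nonneg (by linarith) fun u _ => hφ0 u
  calc c⁻¹ * ∫ u in d..(d + c * t), φ u ≤ 1 * ∫ u in d..(d + c * t), φ u := by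
        gcongr
        exact inv_le_one_of_one_le₀ hc
    _ ≤ _ := by rwa [one_mul]

theorem Continuous.mul_le_integral_of_le_sum {φ : ℝ → ℝ} (hφ : Continuous φ)
    (hφ0 : ∀ u, 0 ≤ φ u) {k : ℕ} {t h X M : ℝ} (hM : 0 ≤ M) (hh : 0 ≤ h) (hht : h ≤ t)
    (hX : ∀ v, 0 ≤ v → v ≤ t →
      X ≤ M * ∑ l ∈ range k, (φ ((l + 1) * v) + φ (h + (l + 1) * v))) :
    t * X ≤ M * (2 * k) * ∫ u in (0 : ℝ)..((k + 1) * t), φ u := by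
  have ht : 0 ≤ t := hh.trans hht
  calc t * X = ∫ _v in (0 : ℝ)..t, X := by simp
    _ ≤ ∫ v in (0 : ℝ)..t,
          M * ∑ l ∈ range k, (φ ((l + 1) * v) + φ (h + (l + 1) * v)) :=
      integral_mono_on ht (by simp) (Continuous.intervalIntegrable (by fun_prop) _ _)
        fun v hv => hX v hv.1 hv.2
    _ = M * ∑ l ∈ range k, ((∫ v in (0 : ℝ)..t, φ (0 + (l + 1) * v)) +
          ∫ v in (0 : ℝ)..t, φ (h + (l + 1) * v)) := by
      rw [intervalIntegral.integral_const_mul, integral_finsetSum fun l _ =>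
        Continuous.intervalIntegrable (by fun_prop) _ _]
      congr 1
      refine sum_congr rfl fun l _ => ?_
      rw [integral_add (Continuous.intervalIntegrable (by fun_prop) _ _)
        (Continuous.intervalIntegrable (by fun_prop) _ _)]
      simp
    _ ≤ M * ∑ l ∈ range k, ((∫ u in (0 : ℝ)..((k + 1) * t), φ u) +
          ∫ u in (0 : ℝ)..((k + 1) * t), φ u) := by
      gcongr with l hl
      all_goals
        have hl' : (l : ℝ) + 1 ≤ k := by exact_mod_cast mem_range.mp hl
        refine hφ.integral_comp_add_mul_le hφ0 (by first | exact hh | exact le_rfl)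
          (by simp) ht ?_
        nlinarith
    _ = _ := by
      rw [sum_const, card_range, nsmul_eq_mul]
      ring

end Real

section Semigroup

variable {B : Type*} [NormedAddCommGroup B] [NormedSpace ℝ B]

/-- A C₀ semigroup of contractions `(T(t))_{t≥0}` on a real normed space. -/
structure IsContractionSemigroup (T : ℝ → B →L[ℝ] B) : Prop where
  map_zero : T 0 = 1
  map_add : ∀ t u : ℝ, 0 ≤ t → 0 ≤ u → T (t + u) = T t * T u
  tendsto : ∀ f : B, Tendsto (fun t : ℝ => T t f) (nhdsWithin 0 (Set.Ioi 0)) (nhds f)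
  norm_le : ∀ t : ℝ, 0 ≤ t → ∀ f : B, ‖T t f‖ ≤ ‖f‖

namespace IsContractionSemigroup

variable {T : ℝ → B →L[ℝ] B}

theorem commute (hT : IsContractionSemigroup T) {t u : ℝ} (ht : 0 ≤ t) (hu : 0 ≤ u) :
    Commute (T t) (T u) := by
  rw [commute_iff_eq, ← hT.map_add t u ht hu, ← hT.map_add u t hu ht, add_comm]

theorem map_natCast_mul (hT : IsContractionSemigroup T) {u : ℝ} (hu : 0 ≤ u) (n : ℕ) :
    T (n * u) = T u ^ n := by
  induction n with
  | zero => simp [hT.map_zero]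
  | succ n ih =>
    rw [Nat.cast_succ, add_mul, one_mul, hT.map_add _ _ (by positivity) hu, ih, pow_succ]

theorem norm_sub_le (hT : IsContractionSemigroup T) {a b : ℝ} (ha : 0 ≤ a) (hb : 0 ≤ b) (f : B) :
    ‖T a f - T b f‖ ≤ ‖T |a - b| f - f‖ := by
  wlog h : b ≤ a generalizing a b
  · rw [norm_sub_rev, abs_sub_comm]
    exact this hb ha (le_of_not_ge h)
  have : T a = T b * T (a - b) := by rw [← hT.map_add b _ hb (by linarith)]; simp
  rw [abs_of_nonneg (by linarith), this, mul_apply_eq_comp, ← _root_.map_sub]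
  exact hT.norm_le b hb _

theorem continuous_abs (hT : IsContractionSemigroup T) (f : B) :
    Continuous fun u : ℝ => T |u| f := by
  have h0 : ContinuousWithinAt (fun t : ℝ => T t f) (Set.Ici 0) 0 := by
    rw [← continuousWithinAt_Ioi_iff_Ici]
    simpa [ContinuousWithinAt, hT.map_zero] using hT.tendsto f
  rw [continuous_iff_continuousAt]
  intro u
  rw [ContinuousAt, tendsto_iff_norm_sub_tendsto_zero]
  have hlim : Tendsto (fun v : ℝ => |(|v| - |u|)|) (nhds u) (nhdsWithin 0 (Set.Ici 0)) := by
    refine tendsto_nhdsWithin_iff.mpr ⟨?_, Eventually.of_forall fun v => Set.mem_Ici.mpr (abs_nonneg _)⟩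
    have : Continuous fun v : ℝ => |(|v| - |u|)| := by fun_prop
    simpa using this.tendsto u
  have h1 : Tendsto (fun v : ℝ => ‖T |(|v| - |u|)| f - f‖) (nhds u) (nhds 0) := by
    have := h0.tendsto.comp hlim
    rw [hT.map_zero] at this
    exact tendsto_iff_norm_sub_tendsto_zero.mp this
  exact squeeze_zero (fun _ => norm_nonneg _)
    (fun v => hT.norm_sub_le (abs_nonneg _) (abs_nonneg _) f) h1

theorem continuous_norm_sub_one_pow (hT : IsContractionSemigroup T) (k : ℕ) (f : B) :
    Continuous fun u : ℝ => ‖((T |u| - 1) ^ k) f‖ := by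
  refine Continuous.norm ?_
  have h (u : ℝ) : ((T |u| - 1) ^ k) f = ∑ i ∈ Finset.range (k + 1),
      ((-1) ^ (k + i) * (k.choose i : ℤ)) • T |(i * u)| f := by
    rw [sub_one_pow_eq_sum, sum_apply]
    refine Finset.sum_congr rfl fun i _ => ?_
    rw [abs_mul, Nat.abs_cast, hT.map_natCast_mul (abs_nonneg u), smul_apply]
  simp only [h]
  refine continuous_finsetSum _ fun i _ => ?_
  simp only [← Int.cast_smul_eq_zsmul ℝ]
  refine Continuous.const_smul ?_ _
  exact (hT.continuous_abs f).comp (continuous_const.mul continuous_id)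

theorem le_omegaT (hT : IsContractionSemigroup T) (k : ℕ) (f : B) {u t : ℝ} (hu : 0 ≤ u)
    (hut : u ≤ t) : ‖((T u - 1) ^ k) f‖ ≤ omegaT T k f t := by
  refine le_csSup ⟨2 ^ k * ‖f‖, ?_⟩ ⟨u, hu, hut, rfl⟩
  rintro _ ⟨v, hv, -, rfl⟩
  exact norm_sub_one_pow_apply_le (hT.norm_le v hv) k f

theorem omegaT_nonneg (k : ℕ) (f : B) (t : ℝ) : 0 ≤ omegaT T k f t := by
  refine Real.sSup_nonneg ?_
  rintro _ ⟨v, -, -, rfl⟩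
  exact norm_nonneg _

theorem omegaT_le {k : ℕ} {f : B} {t c : ℝ} (ht : 0 ≤ t)
    (h : ∀ u, 0 ≤ u → u ≤ t → ‖((T u - 1) ^ k) f‖ ≤ c) : omegaT T k f t ≤ c := by
  refine csSup_le ⟨_, 0, le_rfl, ht, rfl⟩ ?_
  rintro _ ⟨v, hv, hvt, rfl⟩
  exact h v hv hvt

theorem rpow_norm_le_sum (hT : IsContractionSemigroup T) {s : ℝ} (hs : 1 ≤ s) {k : ℕ}
    (hk : k ≠ 0) (f : B) {h v : ℝ} (hh : 0 ≤ h) (hv : 0 ≤ v) :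
    ‖((T h - 1) ^ k) f‖ ^ s ≤ ((k : ℝ) ^ (s - 1) * ((2 ^ k) ^ s * 2 ^ s)) *
      ∑ l ∈ Finset.range k, (‖((T |(l + 1) * v| - 1) ^ k) f‖ ^ s +
        ‖((T |h + (l + 1) * v| - 1) ^ k) f‖ ^ s) := by
  have hs0 : 0 ≤ s := by linarith
  have hpow (l : ℕ) : T ((l + 1) * v) = T v ^ (l + 1) := by
    simpa using hT.map_natCast_mul hv (l + 1)
  have h1 := norm_sub_one_pow_apply_le_sum (hT.norm_le h hh) (hT.commute hh hv) hk f
  calc ‖((T h - 1) ^ k) f‖ ^ s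
      ≤ (∑ l ∈ Finset.range k, |(k.choose (l + 1) : ℝ) * (‖((T v ^ (l + 1) - 1) ^ k) f‖ +
          ‖((T h * T v ^ (l + 1) - 1) ^ k) f‖)|) ^ s := by
        refine Real.rpow_le_rpow (norm_nonneg _) (h1.trans ?_) hs0
        exact Finset.sum_le_sum fun l _ => le_abs_self _
    _ ≤ (k : ℝ) ^ (s - 1) * ∑ l ∈ Finset.range k, |(k.choose (l + 1) : ℝ) *
          (‖((T v ^ (l + 1) - 1) ^ k) f‖ + ‖((T h * T v ^ (l + 1) - 1) ^ k) f‖)| ^ s := by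
        simpa using Real.rpow_sum_le_const_mul_sum_rpow (Finset.range k)
          (fun l => (k.choose (l + 1) : ℝ) * (‖((T v ^ (l + 1) - 1) ^ k) f‖ +
            ‖((T h * T v ^ (l + 1) - 1) ^ k) f‖)) hs
    _ ≤ (k : ℝ) ^ (s - 1) * ∑ l ∈ Finset.range k, ((2 ^ k) ^ s * 2 ^ s) *
          (‖((T |(l + 1) * v| - 1) ^ k) f‖ ^ s + ‖((T |h + (l + 1) * v| - 1) ^ k) f‖ ^ s) := by
        gcongr with l _
        have hlv : 0 ≤ (l + 1) * v := by positivity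
        rw [abs_of_nonneg hlv, abs_of_nonneg (add_nonneg hh hlv), hT.map_add h _ hh hlv, hpow,
          abs_of_nonneg (by positivity), Real.mul_rpow (by positivity) (by positivity), mul_assoc]
        gcongr
        · exact_mod_cast Nat.choose_le_two_pow k (l + 1)
        · exact Real.add_rpow_le_two_rpow_mul (norm_nonneg _) (norm_nonneg _) hs0
    _ = _ := by rw [← Finset.mul_sum, ← mul_assoc]

theorem exists_mul_rpow_omegaT_le_integral (hT : IsContractionSemigroup T) {s : ℝ} (hs : 1 ≤ s)
    {k : ℕ} (hk : k ≠ 0) : ∃ M : ℝ, 0 < M ∧ ∀ (f : B) (t : ℝ), 0 < t →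
      t * omegaT T k f t ^ s ≤ M * ∫ u in (0 : ℝ)..((k + 1) * t), ‖((T |u| - 1) ^ k) f‖ ^ s := by
  have hs0 : 0 < s := by linarith
  have hk' : 0 < k := Nat.pos_of_ne_zero hk
  refine ⟨((k : ℝ) ^ (s - 1) * ((2 ^ k) ^ s * 2 ^ s)) * (2 * k), by positivity, fun f t ht => ?_⟩
  set I := ∫ u in (0 : ℝ)..((k + 1) * t), ‖((T |u| - 1) ^ k) f‖ ^ s
  have hI : 0 ≤ I := intervalIntegral.integral_nonneg (by positivity) fun u _ => by positivity
  have hcont : Continuous fun u : ℝ => ‖((T |u| - 1) ^ k) f‖ ^ s :=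
    (hT.continuous_norm_sub_one_pow k f).rpow_const fun _ => Or.inr hs0.le
  rw [← le_div_iff₀' ht, ← Real.le_rpow_inv_iff_of_pos (omegaT_nonneg k f t) (by positivity) hs0]
  refine omegaT_le ht.le fun h hh hht => ?_
  rw [Real.le_rpow_inv_iff_of_pos (norm_nonneg _) (by positivity) hs0, le_div_iff₀' ht]
  exact hcont.mul_le_integral_of_le_sum (fun u => by positivity) (by positivity) hh hht
    fun v hv _ => hT.rpow_norm_le_sum hs hk f hh hv

theorem sum_rpow_norm_le (hT : IsContractionSemigroup T) {s m : ℝ} (hs : 0 < s) (hm : 0 < m)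
    (hstar : ∀ F G : B, (‖F‖ ^ s + m * ‖G‖ ^ s) ^ (1 / s) ≤ max ‖F + G‖ ‖F - G‖)
    {r : ℕ} (hr : 1 ≤ r) (f : B) {u : ℝ} (hu : 0 ≤ u) (N : ℕ) :
    m * (2 : ℝ) ^ (-s) * ∑ j ∈ Finset.range N,
      ((2 : ℝ) ^ (-(r * s))) ^ j * ‖((T (2 ^ j * u) - 1) ^ (r + 1)) f‖ ^ s +
      ((2 : ℝ) ^ (-(r * s))) ^ N * ‖((T (2 ^ N * u) - 1) ^ r) f‖ ^ s ≤
        ‖((T u - 1) ^ r) f‖ ^ s := by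
  induction N with
  | zero => simp
  | succ N ih =>
    have hN : 0 ≤ 2 ^ N * u := by positivity
    have h := rpow_norm_sub_one_pow_ge hs hm hstar (hT.norm_le _ hN) hr f
    have h2 : T (2 ^ (N + 1) * u) = T (2 ^ N * u) ^ 2 := by
      rw [← hT.map_natCast_mul hN, pow_succ]
      congr 1
      push_cast
      ring
    have h' := mul_le_mul_of_nonneg_left h
      (show 0 ≤ ((2 : ℝ) ^ (-(r * s))) ^ N by positivity)
    rw [Finset.sum_range_succ, h2]
    refine le_trans (le_of_eq ?_) ((add_le_add_right h' _).trans ih)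
    ring

theorem exists_sum_rpow_omegaT_le (hT : IsContractionSemigroup T) {s m : ℝ} (hs : 1 ≤ s)
    (hm : 0 < m)
    (hstar : ∀ F G : B, (‖F‖ ^ s + m * ‖G‖ ^ s) ^ (1 / s) ≤ max ‖F + G‖ ‖F - G‖)
    {r : ℕ} (hr : 1 ≤ r) : ∃ E : ℝ, 0 < E ∧ ∀ (f : B) (t : ℝ), 0 < t → ∀ N : ℕ,
      ∑ j ∈ Finset.range N, ((2 : ℝ) ^ (-(r * s))) ^ j * omegaT T (r + 1) f (2 ^ j * t) ^ s ≤
        E * omegaT T r f t ^ s := by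
  have hs0 : 0 < s := by linarith
  obtain ⟨M, hM, hMle⟩ := hT.exists_mul_rpow_omegaT_le_integral hs (Nat.succ_ne_zero r)
  set q : ℝ := (2 : ℝ) ^ (-(r * s)) with hq
  have hq0 : 0 < q := by positivity
  set D : ℝ := m * (2 : ℝ) ^ (-s) with hD
  have hD0 : 0 < D := by positivity
  set K : ℕ := r + 2 with hK
  have hK0 : (0 : ℝ) < K := by rw [hK]; positivity
  refine ⟨M * (K * (((K : ℝ) ^ r) ^ s / D)), by positivity, fun f t ht N => ?_⟩
  set W := omegaT T r f t ^ s with hW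
  have hKt : 0 ≤ K * t := by positivity
  have hcont (j : ℕ) : Continuous fun v : ℝ =>
      q ^ j * ‖((T |2 ^ j * v| - 1) ^ (r + 1)) f‖ ^ s :=
    continuous_const.mul ((((hT.continuous_norm_sub_one_pow (r + 1) f).comp
      (continuous_const.mul continuous_id))).rpow_const fun _ => Or.inr hs0.le)
  have hterm (j : ℕ) : t * (q ^ j * omegaT T (r + 1) f (2 ^ j * t) ^ s) ≤
      M * ∫ v in (0 : ℝ)..(K * t), q ^ j * ‖((T |2 ^ j * v| - 1) ^ (r + 1)) f‖ ^ s := by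
    have h := hMle f (2 ^ j * t) (by positivity)
    have h2 : (0 : ℝ) < 2 ^ j := by positivity
    have hsub : ∫ u in (0 : ℝ)..(((r + 1 : ℕ) + 1) * (2 ^ j * t)),
        ‖((T |u| - 1) ^ (r + 1)) f‖ ^ s =
        2 ^ j * ∫ v in (0 : ℝ)..(K * t), ‖((T |2 ^ j * v| - 1) ^ (r + 1)) f‖ ^ s := by
      rw [intervalIntegral.integral_comp_mul_left
        (fun u => ‖((T |u| - 1) ^ (r + 1)) f‖ ^ s) h2.ne', smul_eq_mul,
        mul_inv_cancel_left₀ h2.ne', mul_zero, hK]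
      congr 1
      push_cast
      ring
    rw [Nat.succ_eq_add_one, hsub, mul_assoc, mul_left_comm M, mul_le_mul_iff_right₀ h2] at h
    rw [intervalIntegral.integral_const_mul, mul_left_comm, mul_left_comm M]
    gcongr
  have hpoint (v : ℝ) (hv : 0 ≤ v) (hvt : v ≤ K * t) :
      ∑ j ∈ Finset.range N, q ^ j * ‖((T |2 ^ j * v| - 1) ^ (r + 1)) f‖ ^ s ≤
        ((K : ℝ) ^ r) ^ s / D * W := by
    have h := hT.sum_rpow_norm_le hs0 hm hstar hr f hv N
    have habs (j : ℕ) : |2 ^ j * v| = 2 ^ j * v := abs_of_nonneg (by positivity)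
    simp only [habs]
    have hvK : 0 ≤ v / K := by positivity
    have hTv : T v = T (v / K) ^ K := by
      rw [← hT.map_natCast_mul hvK, mul_div_cancel₀ _ hK0.ne']
    have hn : ‖((T v - 1) ^ r) f‖ ≤ (K : ℝ) ^ r * omegaT T r f t := by
      rw [hTv]
      refine (norm_pow_sub_one_pow_apply_le (hT.norm_le _ hvK) K r f).trans ?_
      gcongr
      exact hT.le_omegaT r f hvK ((div_le_iff₀' hK0).mpr hvt)
    have hns : ‖((T v - 1) ^ r) f‖ ^ s ≤ ((K : ℝ) ^ r) ^ s * W := by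
      rw [hW, ← Real.mul_rpow (by positivity) (omegaT_nonneg r f t)]
      gcongr
    rw [div_mul_eq_mul_div, le_div_iff₀' hD0]
    have : 0 ≤ q ^ N * ‖((T (2 ^ N * v) - 1) ^ r) f‖ ^ s := by positivity
    linarith
  rw [← mul_le_mul_iff_right₀ ht]
  calc t * ∑ j ∈ Finset.range N, q ^ j * omegaT T (r + 1) f (2 ^ j * t) ^ s
      ≤ M * ∑ j ∈ Finset.range N,
          ∫ v in (0 : ℝ)..(K * t), q ^ j * ‖((T |2 ^ j * v| - 1) ^ (r + 1)) f‖ ^ s := by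
        rw [Finset.mul_sum, Finset.mul_sum]
        exact Finset.sum_le_sum fun j _ => hterm j
    _ = M * ∫ v in (0 : ℝ)..(K * t), ∑ j ∈ Finset.range N,
          q ^ j * ‖((T |2 ^ j * v| - 1) ^ (r + 1)) f‖ ^ s := by
        rw [intervalIntegral.integral_finsetSum fun j _ => (hcont j).intervalIntegrable _ _]
    _ ≤ M * ∫ _v in (0 : ℝ)..(K * t), ((K : ℝ) ^ r) ^ s / D * W := by
        gcongr
        exact intervalIntegral.integral_mono_on hKt
          ((continuous_finsetSum _ fun j _ => hcont j).intervalIntegrable _ _) (by simp)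
          fun v hv => hpoint v hv.1 hv.2
    _ = t * (M * (K * (((K : ℝ) ^ r) ^ s / D)) * W) := by
        rw [intervalIntegral.integral_const, smul_eq_mul, sub_zero]
        ring

end IsContractionSemigroup

end Semigroup

/-- If the norm of a real Banach space `B` satisfies condition (*) with
parameters `s ∈ [2,∞)`, `m > 0`, and `(T(u))_{u≥0}` is a C₀ semigroup of contractions on
`B`, then for every `r ≥ 1` there is `C > 0` with
`ω_T^r(f,t) ≥ C (∑_{j=1}^∞ 2^{−jrs} ω_T^{r+1}(f, 2^j t)^s)^{1/s}` for all `f ∈ B`, `t > 0`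
(and the series converges). -/
theorem stmt16 {B : Type*} [NormedAddCommGroup B] [NormedSpace ℝ B] [CompleteSpace B]
    (s m : ℝ) (hs : 2 ≤ s) (hm : 0 < m)
    (hstar : ∀ F G : B, (‖F‖ ^ s + m * ‖G‖ ^ s) ^ (1 / s) ≤ max ‖F + G‖ ‖F - G‖)
    (T : ℝ → B →L[ℝ] B)
    (hT0 : T 0 = 1)
    (hTsem : ∀ t u : ℝ, 0 ≤ t → 0 ≤ u → T (t + u) = T t ∘L T u)
    (hTc0 : ∀ f : B, Tendsto (fun t : ℝ => T t f) (nhdsWithin 0 (Set.Ioi 0)) (nhds f))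
    (hTcontr : ∀ t : ℝ, 0 ≤ t → ∀ f : B, ‖T t f‖ ≤ ‖f‖)
    (r : ℕ) (hr : 1 ≤ r) :
    ∃ C : ℝ, 0 < C ∧ ∀ f : B, ∀ t : ℝ, 0 < t →
      Summable (fun j : ℕ =>
        (2 : ℝ) ^ (-((j : ℝ) + 1) * r * s) *
          omegaT T (r + 1) f ((2 : ℝ) ^ ((j : ℝ) + 1) * t) ^ s) ∧
      C * (∑' j : ℕ,
          (2 : ℝ) ^ (-((j : ℝ) + 1) * r * s) *
            omegaT T (r + 1) f ((2 : ℝ) ^ ((j : ℝ) + 1) * t) ^ s) ^ (1 / s)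
        ≤ omegaT T r f t := by
  have hT : IsContractionSemigroup T := ⟨hT0, hTsem, hTc0, hTcontr⟩
  have hs0 : 0 < s := by linarith
  obtain ⟨E, hE, hsum⟩ := hT.exists_sum_rpow_omegaT_le (by linarith) hm hstar hr
  have hterm (f : B) (t : ℝ) (j : ℕ) : (2 : ℝ) ^ (-((j : ℝ) + 1) * r * s) *
      omegaT T (r + 1) f ((2 : ℝ) ^ ((j : ℝ) + 1) * t) ^ s =
      ((2 : ℝ) ^ (-(r * s))) ^ (j + 1) * omegaT T (r + 1) f (2 ^ (j + 1) * t) ^ s := by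
    have h2 : (2 : ℝ) ^ ((j : ℝ) + 1) = 2 ^ (j + 1) := by
      rw [← Real.rpow_natCast]
      push_cast
      rfl
    rw [h2, ← Real.rpow_natCast ((2 : ℝ) ^ (-(r * s))), ← Real.rpow_mul zero_le_two]
    congr 2
    push_cast
    ring
  refine ⟨(E ^ (1 / s))⁻¹, by positivity, fun f t ht => ?_⟩
  have hω : ∀ t, 0 ≤ omegaT T (r + 1) f t := IsContractionSemigroup.omegaT_nonneg (r + 1) f
  have hωr : 0 ≤ omegaT T r f t := IsContractionSemigroup.omegaT_nonneg r f t
  have hnonneg (j : ℕ) : 0 ≤ ((2 : ℝ) ^ (-(r * s))) ^ j *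
      omegaT T (r + 1) f (2 ^ j * t) ^ s := by
    have := hω (2 ^ j * t)
    positivity
  have hbound (N : ℕ) : ∑ j ∈ Finset.range N, ((2 : ℝ) ^ (-(r * s))) ^ (j + 1) *
      omegaT T (r + 1) f (2 ^ (j + 1) * t) ^ s ≤ E * omegaT T r f t ^ s := by
    have h := hsum f t ht (N + 1)
    rw [Finset.sum_range_succ'] at h
    linarith [hnonneg 0]
  simp only [hterm]
  refine ⟨summable_of_sum_range_le (fun j => hnonneg (j + 1)) hbound, ?_⟩
  have htsum := Real.tsum_le_of_sum_range_le (fun j => hnonneg (j + 1)) hbound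
  rw [inv_mul_le_iff₀ (by positivity)]
  calc (∑' j : ℕ, ((2 : ℝ) ^ (-(r * s))) ^ (j + 1) *
        omegaT T (r + 1) f (2 ^ (j + 1) * t) ^ s) ^ (1 / s)
      ≤ (E * omegaT T r f t ^ s) ^ (1 / s) :=
        Real.rpow_le_rpow (tsum_nonneg fun j => hnonneg (j + 1)) htsum (by positivity)
    _ = E ^ (1 / s) * omegaT T r f t := by
        rw [Real.mul_rpow hE.le (by positivity), ← Real.rpow_mul hωr, mul_one_div_cancel hs0.ne',
          Real.rpow_one]
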